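/- Let 0 < a ≤ π/2 and, for an integer d ≥ 1, let V_d = V_d(a/d) be the Chebyshev-segment Vandermonde matrix with arc parameter ρ = a/d. Then V_d is invertible and its inverse satisfies the Frobenius-norm bound ‖V_d⁻¹‖_F ≤ π·d / (2√2·a). -/

import Mathlib

open Real Matrix

/-- The Frobenius norm of a real `d × d` matrix. -/
noncomputable def frobNorm {d : ℕ} (A : Matrix (Fin d) (Fin d) ℝ) : ℝ :=
  Real.sqrt (∑ i : Fin d, ∑ j : Fin d, (A i j) ^ 2)

lemma aux_cos_sum (x : ℝ) (n : ℕ) :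
    2 * Real.sin x * ∑ k ∈ Finset.range n, Real.cos ((2 * k + 1) * x) = Real.sin (2 * n * x) := by
  induction n with
  | zero => simp
  | succ n ih =>
    rw [Finset.sum_range_succ, mul_add, ih]
    have h1 : 2 * ((n + 1 : ℕ) : ℝ) * x = (2 * n + 1) * x + x := by push_cast; ring
    have h2 : 2 * (n : ℝ) * x = (2 * n + 1) * x - x := by ring
    rw [h1, h2, Real.sin_add, Real.sin_sub]; ring

lemma aux_cos_zero (d : ℕ) (hd : 1 ≤ d) (m : ℤ) (h0 : m ≠ 0) (h1 : -(2 * d : ℤ) < m)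
    (h2 : m < 2 * d) :
    ∑ k : Fin d, Real.cos ((2 * k.1 + 1) * (m * π / (2 * d))) = 0 := by
  rw [Fin.sum_univ_eq_sum_range (fun k : ℕ => Real.cos ((2 * k + 1) * (m * π / (2 * d)))) d]
  have hd' : (0 : ℝ) < d := by exact_mod_cast hd
  have h := aux_cos_sum (m * π / (2 * d)) d
  have e : 2 * (d : ℝ) * (m * π / (2 * d)) = m * π := by field_simp
  rw [e, Real.sin_int_mul_pi] at h
  have h1' : -(2 * d : ℝ) < m := by exact_mod_cast h1
  have h2' : (m : ℝ) < 2 * d := by exact_mod_cast h2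
  have h0' : (m : ℝ) ≠ 0 := by exact_mod_cast h0
  have hs : Real.sin (m * π / (2 * d)) ≠ 0 := by
    intro hs
    rw [Real.sin_eq_zero_iff_of_lt_of_lt] at hs
    · have : (m : ℝ) * π ≠ 0 := mul_ne_zero h0' Real.pi_ne_zero
      exact (div_ne_zero this (by positivity)) hs
    · rw [lt_div_iff₀ (by positivity)]; nlinarith [Real.pi_pos]
    · rw [div_lt_iff₀ (by positivity)]; nlinarith [Real.pi_pos]
  simpa [hs] using h

lemma aux_prod (d : ℕ) (i j : Fin d) :
    ∑ k : Fin d, Real.sin ((i.1 + 1) * ((2 * k.1 + 1) * π / (2 * d)))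
      * Real.sin ((j.1 + 1) * ((2 * k.1 + 1) * π / (2 * d))) =
    (∑ k : Fin d, Real.cos ((2 * k.1 + 1) * (((i.1 - j.1 : ℤ) : ℝ) * π / (2 * d)))
      - ∑ k : Fin d, Real.cos ((2 * k.1 + 1) * (((i.1 + j.1 + 2 : ℤ) : ℝ) * π / (2 * d)))) / 2 := by
  rw [← Finset.sum_sub_distrib, Finset.sum_div]
  refine Finset.sum_congr rfl fun k _ => ?_
  have e1 : (2 * (k.1 : ℝ) + 1) * (((i.1 - j.1 : ℤ) : ℝ) * π / (2 * d))
    = (i.1 + 1) * ((2 * k.1 + 1) * π / (2 * d)) - (j.1 + 1) * ((2 * k.1 + 1) * π / (2 * d)) := by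
    push_cast; ring
  have e2 : (2 * (k.1 : ℝ) + 1) * (((i.1 + j.1 + 2 : ℤ) : ℝ) * π / (2 * d))
    = (i.1 + 1) * ((2 * k.1 + 1) * π / (2 * d)) + (j.1 + 1) * ((2 * k.1 + 1) * π / (2 * d)) := by
    push_cast; ring
  rw [e1, e2, Real.cos_sub, Real.cos_add]; ring

lemma aux_off (d : ℕ) (i j : Fin d) (h : i ≠ j) :
    ∑ k : Fin d, Real.sin ((i.1 + 1) * ((2 * k.1 + 1) * π / (2 * d)))
      * Real.sin ((j.1 + 1) * ((2 * k.1 + 1) * π / (2 * d))) = 0 := by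
  have hi := i.2
  have hj := j.2
  have h' : i.1 ≠ j.1 := fun e => h (Fin.ext e)
  rw [aux_prod, aux_cos_zero d (by omega) _ (by omega) (by omega) (by omega),
    aux_cos_zero d (by omega) _ (by omega) (by omega) (by omega)]
  simp

lemma aux_diag (d : ℕ) (i : Fin d) :
    (d : ℝ) / 2 ≤ ∑ k : Fin d, Real.sin ((i.1 + 1) * ((2 * k.1 + 1) * π / (2 * d)))
      * Real.sin ((i.1 + 1) * ((2 * k.1 + 1) * π / (2 * d))) := by
  have hi := i.2
  have hd' : (0 : ℝ) < d := by exact_mod_cast (by omega : 0 < d)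
  rw [aux_prod]
  have h1 : ∑ k : Fin d, Real.cos ((2 * k.1 + 1) * (((i.1 - i.1 : ℤ) : ℝ) * π / (2 * d))) = d := by
    simp
  have h2 : ∑ k : Fin d, Real.cos ((2 * k.1 + 1) * (((i.1 + i.1 + 2 : ℤ) : ℝ) * π / (2 * d)))
      ≤ 0 := by
    by_cases hc : i.1 + 1 = d
    · refine Finset.sum_nonpos fun k _ => ?_
      have e : (2 * (k.1 : ℝ) + 1) * (((i.1 + i.1 + 2 : ℤ) : ℝ) * π / (2 * d))
          = π + (k.1 : ℝ) * (2 * π) := by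
        have : ((i.1 + i.1 + 2 : ℤ) : ℝ) = 2 * d := by
          have : (i.1 : ℝ) + 1 = d := by exact_mod_cast hc
          push_cast; linarith
        rw [this]; field_simp; ring
      rw [e, Real.cos_add_nat_mul_two_pi, Real.cos_pi]; norm_num
    · rw [aux_cos_zero d (by omega) _ (by omega) (by omega) (by omega)]
  linarith

/-- for the Chebyshev-segment Vandermonde matrix with arc
parameter `ρ = a/d`, `0 < a ≤ π/2`, `V_d` is invertible and
`‖V_d⁻¹‖_F ≤ π d / (2√2 a)`. -/
theorem stmt_14 (a : ℝ) (ha : 0 < a) (ha' : a ≤ π / 2)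
    (d : ℕ) (hd : 1 ≤ d)
    (V : Matrix (Fin d) (Fin d) ℝ)
    (hV : ∀ k j : Fin d,
      V k j = 2 / (j.1 + 1)
        * Real.sin ((j.1 + 1) * ((2 * k.1 + 1) * π / (2 * d)))
        * Real.sin ((j.1 + 1) * (a / d))) :
    IsUnit V.det ∧ frobNorm V⁻¹ ≤ π * d / (2 * Real.sqrt 2 * a) := by
  have hd' : (0 : ℝ) < d := by exact_mod_cast hd
  set s : Fin d → Fin d → ℝ :=
    fun j k => Real.sin ((j.1 + 1) * ((2 * k.1 + 1) * π / (2 * d))) with hs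
  set w : Fin d → ℝ := fun j => ∑ k, s j k * s j k with hw
  set D : Fin d → ℝ := fun j => 2 / (j.1 + 1) * Real.sin ((j.1 + 1) * (a / d)) with hD
  have hwb : ∀ j, (d : ℝ) / 2 ≤ w j := fun j => aux_diag d j
  have hwp : ∀ j, 0 < w j := fun j => lt_of_lt_of_le (by positivity) (hwb j)
  have hDb : ∀ j, 4 * a / (π * d) ≤ D j := by
    intro j
    have hj : (j.1 : ℝ) + 1 ≤ d := by exact_mod_cast j.2
    have hx : ((j.1 : ℝ) + 1) * (a / d) ≤ π / 2 := by
      refine le_trans ?_ ha'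
      rw [mul_div_assoc', div_le_iff₀ hd']
      nlinarith
    have h := Real.mul_le_sin (x := ((j.1 : ℝ) + 1) * (a / d)) (by positivity) hx
    calc 4 * a / (π * d) = 2 / (j.1 + 1) * (2 / π * (((j.1 : ℝ) + 1) * (a / d))) := by
          field_simp; norm_num
      _ ≤ _ := mul_le_mul_of_nonneg_left h (by positivity)
  have hDp : ∀ j, 0 < D j := fun j => lt_of_lt_of_le (by positivity) (hDb j)
  have hVs : ∀ k j, V k j = D j * s j k := by
    intro k j; rw [hV]; simp only [hD, hs]; ring
  set W : Matrix (Fin d) (Fin d) ℝ := Matrix.of fun j k => s j k / (w j * D j) with hW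
  have hWV : W * V = 1 := by
    ext i j
    rw [Matrix.mul_apply]
    have e : ∑ k, W i k * V k j = D j / (w i * D i) * ∑ k, s i k * s j k := by
      rw [Finset.mul_sum]
      refine Finset.sum_congr rfl fun k _ => ?_
      rw [hVs]; simp only [hW, Matrix.of_apply]; ring
    rw [e]
    by_cases hij : i = j
    · subst hij
      rw [Matrix.one_apply_eq]
      change D i / (w i * D i) * w i = 1
      have := (hwp i).ne'
      have := (hDp i).ne'
      field_simp
    · rw [Matrix.one_apply_ne hij, show ∑ k, s i k * s j k = 0 from aux_off d i j hij, mul_zero]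
  refine ⟨(Matrix.isUnit_iff_isUnit_det V).1 (IsUnit.of_mul_eq_one_right W hWV), ?_⟩
  rw [Matrix.inv_eq_left_inv hWV, frobNorm]
  apply Real.sqrt_le_iff.2
  refine ⟨by positivity, ?_⟩
  have hrow : ∀ j, ∑ k, W j k ^ 2 ≤ (2 / d) * (π * d / (4 * a)) ^ 2 := by
    intro j
    have e : ∑ k, W j k ^ 2 = 1 / (w j) * (1 / D j) ^ 2 := by
      have : ∑ k, W j k ^ 2 = w j / (w j * D j) ^ 2 := by
        simp only [hw, Finset.sum_div]
        refine Finset.sum_congr rfl fun k _ => ?_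
        simp only [hW, Matrix.of_apply, hw]; rw [div_pow]; ring
      rw [this]
      have := (hwp j).ne'
      have := (hDp j).ne'
      field_simp
    rw [e]
    have h1 : 1 / w j ≤ 2 / d := by
      have := one_div_le_one_div_of_le (by positivity) (hwb j)
      rwa [one_div_div] at this
    have h2 : 1 / D j ≤ π * d / (4 * a) := by
      have := one_div_le_one_div_of_le (by positivity) (hDb j)
      rwa [one_div_div] at this
    have := hwp j
    have := hDp j
    gcongr
  calc ∑ i, ∑ j, W i j ^ 2 ≤ ∑ i : Fin d, (2 / d) * (π * d / (4 * a)) ^ 2 :=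
        Finset.sum_le_sum fun i _ => hrow i
    _ = (π * d / (2 * Real.sqrt 2 * a)) ^ 2 := by
        rw [Finset.sum_const, Finset.card_univ, Fintype.card_fin, nsmul_eq_mul]
        have h2 : Real.sqrt 2 ^ 2 = 2 := Real.sq_sqrt (by norm_num)
        rw [div_pow, div_pow, mul_pow (2 * Real.sqrt 2), mul_pow 2 (Real.sqrt 2), h2]
        field_simp; norm_num
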